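/- arXiv:2508.00182 — 2 statements merged into one kernel-verified Lean document; each statement's English description precedes it below -/
import Mathlib

section
/- Let τ = τ_F. Then for every s ≥ 1: (i) for every dyadic cube Δ of rank m_s, τ(Δ) = 2^{s−1−d·m_s} if Δ ⊆ F̃_{s−1}, and τ(Δ) = 0 otherwise; (ii) for every dyadic cube Δ of rank 2m_s+1, τ(Δ) = 2^{s−d(2m_s+1)} if Δ ⊆ F̃_s, and τ(Δ) = 0 otherwise. -/
open Filter Finset Topology MeasureTheory
open scoped Classical

noncomputable section

instance : TopologicalSpace (ZMod 2) := ⊥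
instance : DiscreteTopology (ZMod 2) := ⟨rfl⟩

/-- The dyadic (Cantor) group `𝔾`: sequences of elements of `ℤ/2ℤ`
with coordinatewise addition modulo 2, Tychonoff topology. -/
abbrev DyadicGroup : Type := ℕ → ZMod 2

instance : MeasurableSpace DyadicGroup := borel _
instance : BorelSpace DyadicGroup := ⟨rfl⟩

/-- `𝔾^d`. -/
abbrev GD (d : ℕ) : Type := Fin d → DyadicGroup

/-- One-dimensional Walsh function `W_n` in the Paley enumeration:
`W_n(g) = ∏_k (-1)^(g_k n_k)`. -/
def walsh (n : ℕ) (g : DyadicGroup) : ℝ :=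
  ∏ k ∈ Finset.range n, if n.testBit k ∧ g k = 1 then (-1 : ℝ) else 1

/-- `d`-dimensional Walsh function `W_𝐧(𝐠) = ∏ W_{n^l}(g^l)`. -/
def walshD {d : ℕ} (n : Fin d → ℕ) (g : GD d) : ℝ :=
  ∏ l, walsh (n l) (g l)

/-- The dyadic interval `Δ^{(k)}_m` of rank `k`. -/
def dyadicInterval (k m : ℕ) : Set DyadicGroup :=
  {g | ∀ t < k, g t = if m.testBit (k - 1 - t) then 1 else 0}

/-- The dyadic cube `Δ^{(k)}_𝐦 = Δ^{(k)}_{m^1} × ⋯ × Δ^{(k)}_{m^d}`. -/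
def dyadicCube {d : ℕ} (k : ℕ) (m : Fin d → ℕ) : Set (GD d) :=
  {g | ∀ l, g l ∈ dyadicInterval k (m l)}

/-- The canonical point of `Δ^{(k)}_m`. -/
def intervalPoint (k m : ℕ) : DyadicGroup :=
  fun t => if t < k ∧ m.testBit (k - 1 - t) then 1 else 0

/-- The canonical point of `Δ^{(k)}_𝐦`. -/
def cubePoint {d : ℕ} (k : ℕ) (m : Fin d → ℕ) : GD d :=
  fun l => intervalPoint k (m l)

/-- `W^{(k)}_{n,m}`: the (constant, for `n < 2^k`) value of `W_n` on `Δ^{(k)}_m`. -/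
def walshVal (k n m : ℕ) : ℝ := walsh n (intervalPoint k m)

/-- `W^{(k)}_{𝐧𝐦}`: the (constant, for `𝐧 < 2^k·𝟏`) value of `W_𝐧` on `Δ^{(k)}_𝐦`. -/
def walshValD {d : ℕ} (k : ℕ) (n m : Fin d → ℕ) : ℝ := walshD n (cubePoint k m)

/-- The box `{𝐧 : 𝐧 < 𝐍}` as a finset. -/
def boxLt {d : ℕ} (N : Fin d → ℕ) : Finset (Fin d → ℕ) :=
  Fintype.piFinset fun l => Finset.range (N l)

/-- The box `{0,…,2^k−1}^d` as a set. -/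
def box (d k : ℕ) : Set (Fin d → ℕ) := {m | ∀ l, m l < 2 ^ k}

/-- The rectangular partial sum `S_𝐍(𝐠)` of the Walsh series with coefficients `a`. -/
def walshPartialSum {d : ℕ} (a : (Fin d → ℕ) → ℂ) (N : Fin d → ℕ) (g : GD d) : ℂ :=
  ∑ n ∈ boxLt N, a n * (walshD n g : ℂ)

/-- Convergence over rectangles: `S_𝐍(𝐠) → S` as `min_j N^j → ∞`. -/
def ConvergesOverRectangles {d : ℕ} (a : (Fin d → ℕ) → ℂ) (g : GD d) (S : ℂ) : Prop :=
  Tendsto (fun N : Fin d → ℕ => walshPartialSum a N g) atTop (𝓝 S)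

/-- Convergence over cubes: `S_{N𝟏}(𝐠) → S` as `N → ∞`. -/
def ConvergesOverCubes {d : ℕ} (a : (Fin d → ℕ) → ℂ) (g : GD d) (S : ℂ) : Prop :=
  Tendsto (fun N : ℕ => walshPartialSum a (fun _ => N) g) atTop (𝓝 S)

/-- `λ`-convergence: `S_𝐍(𝐠) → S` as `min_j N^j → ∞` along `𝐍` with `max N^j/N^k ≤ λ`. -/
def LambdaConverges {d : ℕ} (lam : ℝ) (a : (Fin d → ℕ) → ℂ) (g : GD d) (S : ℂ) : Prop :=
  ∀ ε : ℝ, 0 < ε → ∃ K : ℕ, ∀ N : Fin d → ℕ, (∀ j, K ≤ N j) →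
    (∀ j k, (N j : ℝ) ≤ lam * N k) → ‖walshPartialSum a N g - S‖ < ε

/-- Auxiliary predicate for iterated summation of a multiple series with terms `f`;
the list gives the order of summation, *innermost index first*.  After summing the
series in the variables of the list, the remaining (partially summed) function is `g`. -/
def IterConvAux {d : ℕ} : List (Fin d) → ((Fin d → ℕ) → ℂ) → ((Fin d → ℕ) → ℂ) → Prop
  | [], f, g => f = g
  | j :: rest, f, g => ∃ h : (Fin d → ℕ) → ℂ,
      (∀ n, Tendsto (fun T : ℕ => ∑ t ∈ Finset.range T, f (Function.update n j t))
        atTop (𝓝 (h n))) ∧ IterConvAux rest h g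

/-- The multiple series with terms `f` converges iteratedly to `S`, the order of
summation being given by the list `l` (innermost index first): all successively
nested inner series converge and the full iterated sum equals `S`. -/
def IterConverges {d : ℕ} (l : List (Fin d)) (f : (Fin d → ℕ) → ℂ) (S : ℂ) : Prop :=
  ∃ g, IterConvAux l f g ∧ ∀ n, g n = S

/-- `A` is an M-set for the `d`-dimensional Walsh system under rectangular convergence. -/
def IsMSetRect {d : ℕ} (A : Set (GD d)) : Prop :=
  ∃ a : (Fin d → ℕ) → ℂ, (∃ n, a n ≠ 0) ∧ ∀ g ∉ A, ConvergesOverRectangles a g 0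

/-- `A` is an M-set for the `d`-dimensional Walsh system under convergence over cubes. -/
def IsMSetCubes {d : ℕ} (A : Set (GD d)) : Prop :=
  ∃ a : (Fin d → ℕ) → ℂ, (∃ n, a n ≠ 0) ∧ ∀ g ∉ A, ConvergesOverCubes a g 0

/-- `A` is an M-set under iterated convergence with summation order `l` (innermost first). -/
def IsMSetIter {d : ℕ} (A : Set (GD d)) (l : List (Fin d)) : Prop :=
  ∃ a : (Fin d → ℕ) → ℂ, (∃ n, a n ≠ 0) ∧
    ∀ g ∉ A, IterConverges l (fun n => a n * (walshD n g : ℂ)) 0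

/-- `A` is an M-set for the `d`-dimensional Walsh system under `λ`-convergence. -/
def IsMSetLambda {d : ℕ} (lam : ℝ) (A : Set (GD d)) : Prop :=
  ∃ a : (Fin d → ℕ) → ℂ, (∃ n, a n ≠ 0) ∧ ∀ g ∉ A, LambdaConverges lam a g 0

/-- A quasimeasure: a finitely additive function on dyadic cubes (indexed by rank
`k` and position `𝐦 < 2^k·𝟏`). -/
def IsQuasimeasure {d : ℕ} (τ : ℕ → (Fin d → ℕ) → ℂ) : Prop :=
  ∀ k m, (∀ l, m l < 2 ^ k) →
    τ k m = ∑ σ : Fin d → Fin 2, τ (k + 1) fun l => 2 * m l + (σ l : ℕ)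

/-- The quasimeasure generated by the Walsh series with coefficients `a`:
`τ(Δ^{(k)}_𝐦) = 2^{-kd} ∑_{𝐧<2^k𝟏} a_𝐧 W_𝐧(Δ^{(k)}_𝐦)`. -/
def genQM {d : ℕ} (a : (Fin d → ℕ) → ℂ) (k : ℕ) (m : Fin d → ℕ) : ℂ :=
  ((2 : ℂ) ^ (k * d))⁻¹ * ∑ n ∈ boxLt (fun _ : Fin d => 2 ^ k), a n * (walshValD k n m : ℂ)

/-- The Fourier–Walsh coefficient `τ̂_𝐧` of a quasimeasure `τ`, computed at resolution `k`
(the value does not depend on `k` as long as `𝐧 < 2^k𝟏`). -/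
def fourierCoeffAt {d : ℕ} (τ : ℕ → (Fin d → ℕ) → ℂ) (n : Fin d → ℕ) (k : ℕ) : ℂ :=
  ∑ m ∈ boxLt (fun _ : Fin d => 2 ^ k), (walshValD k n m : ℂ) * τ k m

/-- The local Fourier–Walsh coefficient `τ̂_𝐧(Δ^{(r)}_{𝐦Δ})`, computed at resolution `k ≥ r`. -/
def localCoeffAt {d : ℕ} (τ : ℕ → (Fin d → ℕ) → ℂ) (n : Fin d → ℕ)
    (r : ℕ) (mΔ : Fin d → ℕ) (k : ℕ) : ℂ :=
  ∑ m ∈ (boxLt (fun _ : Fin d => 2 ^ k)).filter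
      (fun m => dyadicCube k m ⊆ dyadicCube r mΔ),
    (walshValD k n m : ℂ) * τ k m

/-- The support of a quasimeasure: the complement of the union of all dyadic cubes `Δ₀`
such that `τ(Δ) = 0` for every dyadic cube `Δ ⊆ Δ₀`. -/
def qmSupport {d : ℕ} (τ : ℕ → (Fin d → ℕ) → ℂ) : Set (GD d) :=
  (⋃ k, ⋃ m ∈ box d k,
    ⋃ (_ : ∀ k' m', (∀ l, m' l < 2 ^ k') →
        dyadicCube k' m' ⊆ dyadicCube k m → τ k' m' = 0),
    dyadicCube k m)ᶜ

/-- The restriction `τ|_{Δ̃}` of a quasimeasure to the dyadic cube `Δ̃ = Δ^{(r)}_{𝐦Δ}`: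
`τ|_{Δ̃}(Δ) = τ(Δ̃ ∩ Δ)` (two dyadic cubes are nested or disjoint). -/
def restrictQM {d : ℕ} (τ : ℕ → (Fin d → ℕ) → ℂ) (r : ℕ) (mΔ : Fin d → ℕ) :
    ℕ → (Fin d → ℕ) → ℂ := fun k m =>
  if dyadicCube k m ⊆ dyadicCube (d := d) r mΔ then τ k m
  else if dyadicCube (d := d) r mΔ ⊆ dyadicCube k m then τ r mΔ
  else 0

/-- `τ` is the canonical quasimeasure `τ_E` associated with a (nonempty closed) set `E`:
`τ(𝔾^d) = 1`; `τ(Δ) = 0` iff `Δ ∩ E = ∅`; and the mass of a cube meeting `E` is divided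
equally among its `2^d` immediate subcubes that meet `E`. -/
def IsTauOf {d : ℕ} (E : Set (GD d)) (τ : ℕ → (Fin d → ℕ) → ℂ) : Prop :=
  IsQuasimeasure τ ∧
  τ 0 (fun _ => 0) = 1 ∧
  (∀ k m, (∀ l, m l < 2 ^ k) → (τ k m = 0 ↔ dyadicCube k m ∩ E = ∅)) ∧
  (∀ k m, (∀ l, m l < 2 ^ k) → (dyadicCube k m ∩ E).Nonempty →
    ∀ σ : Fin d → Fin 2,
      τ (k + 1) (fun l => 2 * m l + (σ l : ℕ)) =
        if (dyadicCube (k + 1) (fun l => 2 * m l + (σ l : ℕ)) ∩ E).Nonempty then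
          τ k m / ((Finset.univ.filter fun σ' : Fin d → Fin 2 =>
              (dyadicCube (k + 1) (fun l => 2 * m l + (σ' l : ℕ)) ∩ E).Nonempty).card : ℂ)
        else 0)

/-- The sequence `m_s`: `m_1 = 0`, `m_{s+1} = 2(2m_s+1)` (value at `0` is junk). -/
def mSeq : ℕ → ℕ
  | 0 => 0
  | s + 1 => if s = 0 then 0 else 2 * (2 * mSeq s + 1)

/-- The layer `F_s^π`. -/
def Fspi {d : ℕ} (π : ℕ → (Fin d → ℕ) → Fin d → ℕ) (s : ℕ) : Set (GD d) :=
  ⋃ m ∈ box d (mSeq s), ⋃ m' ∈ box d (mSeq s),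
    {g | g ∈ dyadicCube (2 * mSeq s) (fun l => 2 ^ mSeq s * m l + m' l) ∧
      walshD (fun _ => 2 ^ (2 * mSeq s)) g = walshValD (mSeq s) (π s m) m'}

/-- `F̃_s^π = F_1^π ∩ ⋯ ∩ F_s^π` (so `F̃_0^π = 𝔾^d`). -/
def Ftil {d : ℕ} (π : ℕ → (Fin d → ℕ) → Fin d → ℕ) (s : ℕ) : Set (GD d) :=
  ⋂ k ∈ Finset.Icc 1 s, Fspi π k

/-- `F^π = ⋂_{s≥1} F_s^π`. -/
def Fpi {d : ℕ} (π : ℕ → (Fin d → ℕ) → Fin d → ℕ) : Set (GD d) :=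
  ⋂ s ∈ Set.Ici 1, Fspi π s

/-- The identity element of `S` (yielding `F_s`, `F̃_s` and `F` themselves). -/
def idPerm (d : ℕ) : ℕ → (Fin d → ℕ) → Fin d → ℕ := fun _ m => m

/-- `S`: sequences `π = (π_s)` of permutations of the boxes `{0,…,2^{m_s}−1}^d`. -/
structure PermSeq (d : ℕ) where
  p : ℕ → Equiv.Perm (Fin d → ℕ)
  maps : ∀ s, Set.MapsTo (p s) (box d (mSeq s)) (box d (mSeq s))

/-- The underlying sequence of functions of an element of `S`. -/
def PermSeq.f {d : ℕ} (π : PermSeq d) : ℕ → (Fin d → ℕ) → Fin d → ℕ := fun s => ⇑(π.p s)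

/-- `π ∈ S'`: every `π_s` acts coordinatewise, `π_s(𝐦) = (π_s^1(m^1),…,π_s^d(m^d))`. -/
def PermSeq.Coordinatewise {d : ℕ} (π : PermSeq d) : Prop :=
  ∀ s, ∃ e : Fin d → ℕ → ℕ, ∀ m : Fin d → ℕ, π.p s m = fun l => e l (m l)

/-- The Dirichlet kernel `D_N = ∑_{n<N} W_n` of the one-dimensional Walsh system. -/
def dirichlet (N : ℕ) (g : DyadicGroup) : ℝ :=
  ∑ n ∈ Finset.range N, walsh n g

lemma aux_interval_succ (n m b : ℕ) (hb : b < 2) (g : DyadicGroup) :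
    g ∈ dyadicInterval (n + 1) (2 * m + b) ↔ g ∈ dyadicInterval n m ∧ g n = (b : ZMod 2) := by
  have key : ∀ t < n, (2 * m + b).testBit (n + 1 - 1 - t) = m.testBit (n - 1 - t) := by
    intro t ht
    have : n + 1 - 1 - t = (n - 1 - t) + 1 := by omega
    rw [this, Nat.testBit_succ]
    congr 1
    omega
  have key0 : (if (2 * m + b).testBit (n + 1 - 1 - n) then (1 : ZMod 2) else 0) = (b : ZMod 2) := by
    have : n + 1 - 1 - n = 0 := by omega
    rw [this, Nat.testBit_zero]
    have : b = 0 ∨ b = 1 := by omega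
    rcases this with rfl | rfl
    · simp
    · simp [Nat.add_mod]
  constructor
  · intro h
    refine ⟨fun t ht => ?_, ?_⟩
    · have := h t (by omega)
      rwa [key t ht] at this
    · have := h n (by omega)
      rwa [key0] at this
  · rintro ⟨h1, h2⟩ t ht
    rcases Nat.lt_succ_iff_lt_or_eq.mp ht with h | h
    · rw [key t h]; exact h1 t h
    · subst h; rw [key0]; exact h2

lemma aux_interval_exists (n : ℕ) (g : DyadicGroup) :
    ∃ m, m < 2 ^ n ∧ g ∈ dyadicInterval n m := by
  induction n with
  | zero => exact ⟨0, by simp, fun t ht => by omega⟩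
  | succ n ih =>
    obtain ⟨m, hm, hg⟩ := ih
    have hv : (g n).val < 2 := ZMod.val_lt (g n)
    refine ⟨2 * m + (g n).val, ?_, ?_⟩
    · rw [pow_succ]; omega
    · rw [aux_interval_succ n m _ hv]
      exact ⟨hg, by simp⟩

lemma aux_interval_unique (n m m' : ℕ) (hm : m < 2 ^ n) (hm' : m' < 2 ^ n) (g : DyadicGroup)
    (h : g ∈ dyadicInterval n m) (h' : g ∈ dyadicInterval n m') : m = m' := by
  apply Nat.eq_of_testBit_eq
  intro j
  by_cases hj : j < n
  · have e : n - 1 - (n - 1 - j) = j := by omega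
    have a := h (n - 1 - j) (by omega)
    have b := h' (n - 1 - j) (by omega)
    rw [e] at a b
    rw [a] at b
    by_cases h1 : m.testBit j <;> by_cases h2 : m'.testBit j <;> simp_all
  · have hp : 2 ^ n ≤ 2 ^ j := Nat.pow_le_pow_right (by norm_num) (by omega)
    rw [Nat.testBit_lt_two_pow (by omega), Nat.testBit_lt_two_pow (by omega)]

lemma aux_walsh_pm (n : ℕ) (g : DyadicGroup) : walsh n g = 1 ∨ walsh n g = -1 := by
  unfold walsh
  refine Finset.prod_induction _ (fun x : ℝ => x = 1 ∨ x = -1) ?_ (Or.inl rfl) ?_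
  · rintro a b (rfl | rfl) (rfl | rfl) <;> simp
  · intro x _
    split_ifs <;> simp

lemma aux_walshD_pm {d : ℕ} (n : Fin d → ℕ) (g : GD d) : walshD n g = 1 ∨ walshD n g = -1 := by
  unfold walshD
  refine Finset.prod_induction _ (fun x : ℝ => x = 1 ∨ x = -1) ?_ (Or.inl rfl) ?_
  · rintro a b (rfl | rfl) (rfl | rfl) <;> simp
  · intro x _
    exact aux_walsh_pm _ _

lemma aux_walsh_two_pow (n : ℕ) (g : DyadicGroup) :
    walsh (2 ^ n) g = if g n = 1 then -1 else 1 := by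
  unfold walsh
  rw [Finset.prod_eq_single n]
  · simp [Nat.testBit_two_pow_self]
  · intro b _ hb
    rw [Nat.testBit_two_pow_of_ne (Ne.symm hb)]
    simp
  · intro h
    exact absurd (Finset.mem_range.mpr Nat.lt_two_pow_self) h

/-- flip the `n`-th digit of the coordinate `i`. -/
def auxFlip {d : ℕ} (i : Fin d) (n : ℕ) (g : GD d) : GD d :=
  fun l t => if l = i ∧ t = n then g l t + 1 else g l t

lemma aux_flip_walsh {d : ℕ} (i : Fin d) (n : ℕ) (g : GD d) :
    walshD (fun _ => 2 ^ n) (auxFlip i n g) = - walshD (fun _ => 2 ^ n) g := by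
  unfold walshD
  simp only [aux_walsh_two_pow]
  rw [← Finset.mul_prod_erase _ _ (Finset.mem_univ i),
    ← Finset.mul_prod_erase _ (fun l => if g l n = 1 then (-1 : ℝ) else 1) (Finset.mem_univ i),
    ← neg_mul]
  congr 1
  · simp only [auxFlip, and_self, if_true]
    generalize g i n = x
    revert x
    have : ∀ x : ZMod 2, x = 0 ∨ x = 1 := by decide
    intro x
    have h2 : (1 : ZMod 2) + 1 = 0 := by decide
    rcases this x with rfl | rfl <;> simp [h2]
  · apply Finset.prod_congr rfl
    intro l hl
    simp [auxFlip, Finset.ne_of_mem_erase hl]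

/-- agreement on digits below `n`. -/
def auxAgree {d : ℕ} (n : ℕ) (g h : GD d) : Prop := ∀ l, ∀ t < n, g l t = h l t

lemma aux_cube_agree {d : ℕ} {n : ℕ} {g h : GD d} (hgh : auxAgree n g h) (m : Fin d → ℕ)
    (hg : g ∈ dyadicCube n m) : h ∈ dyadicCube n m :=
  fun l t ht => (hgh l t ht) ▸ hg l t ht

lemma aux_agree_of_cube {d : ℕ} {n : ℕ} {g h : GD d} (m : Fin d → ℕ)
    (hg : g ∈ dyadicCube n m) (hh : h ∈ dyadicCube n m) : auxAgree n g h :=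
  fun l t ht => (hg l t ht).trans (hh l t ht).symm

lemma aux_agree_walsh {d : ℕ} {n : ℕ} {g h : GD d} (hgh : auxAgree (n + 1) g h) :
    walshD (fun _ => 2 ^ n) g = walshD (fun _ => 2 ^ n) h := by
  unfold walshD
  simp only [aux_walsh_two_pow]
  apply Finset.prod_congr rfl
  intro l _
  rw [hgh l n (by omega)]

lemma aux_F_local {d s : ℕ} {g h : GD d} (hgh : auxAgree (2 * mSeq s + 1) g h)
    (hg : g ∈ Fspi (idPerm d) s) : h ∈ Fspi (idPerm d) s := by
  simp only [Fspi, Set.mem_iUnion, Set.mem_ofPred_eq] at hg ⊢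
  obtain ⟨m, hm, m', hm', hc, hw⟩ := hg
  refine ⟨m, hm, m', hm', aux_cube_agree (fun l t ht => hgh l t (by omega)) _ hc, ?_⟩
  rw [← aux_agree_walsh hgh, hw]

lemma aux_flip_agree {d : ℕ} (i : Fin d) (n : ℕ) (g : GD d) : auxAgree n g (auxFlip i n g) := by
  intro l t ht
  have : ¬ (l = i ∧ t = n) := by omega
  simp [auxFlip, this]

/-- toggling -/
lemma aux_F_toggle {d s : ℕ} (i : Fin d) (g : GD d) :
    auxFlip i (2 * mSeq s) g ∈ Fspi (idPerm d) s ↔ g ∉ Fspi (idPerm d) s := by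
  have hag := aux_flip_agree i (2 * mSeq s) g
  choose a ha hga using fun l => aux_interval_exists (2 * mSeq s) (g l)
  have hpos : 0 < 2 ^ mSeq s := by positivity
  have hsplit : 2 ^ (2 * mSeq s) = 2 ^ mSeq s * 2 ^ mSeq s := by rw [two_mul, pow_add]
  have char : ∀ h : GD d, auxAgree (2 * mSeq s) g h →
      (h ∈ Fspi (idPerm d) s ↔ walshD (fun _ => 2 ^ (2 * mSeq s)) h =
        walshValD (mSeq s) (fun l => a l / 2 ^ mSeq s) (fun l => a l % 2 ^ mSeq s)) := by
    intro h hgh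
    have hha : h ∈ dyadicCube (2 * mSeq s) a := aux_cube_agree hgh a hga
    simp only [Fspi, Set.mem_iUnion, Set.mem_ofPred_eq, idPerm]
    constructor
    · rintro ⟨m, hm, m', hm', hc, hw⟩
      have e : ∀ l, a l = 2 ^ mSeq s * m l + m' l := by
        intro l
        refine aux_interval_unique _ _ _ (ha l) ?_ (h l) (hha l) (hc l)
        have h1 := hm l
        have h2 := hm' l
        rw [hsplit]
        nlinarith
      have e1 : (fun l => a l / 2 ^ mSeq s) = m := by
        funext l
        rw [e l, Nat.mul_add_div hpos, Nat.div_eq_of_lt (hm' l), add_zero]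
      have e2 : (fun l => a l % 2 ^ mSeq s) = m' := by
        funext l
        rw [e l, Nat.mul_add_mod, Nat.mod_eq_of_lt (hm' l)]
      rw [e1, e2]; exact hw
    · intro hw
      refine ⟨_, ?_, _, ?_, ?_, hw⟩
      · intro l
        apply Nat.div_lt_of_lt_mul
        rw [← hsplit]; exact ha l
      · intro l
        exact Nat.mod_lt _ hpos
      · simp only [Nat.div_add_mod]
        exact hha
  rw [char _ hag, char g (fun _ _ _ => rfl), aux_flip_walsh]
  have p1 := aux_walshD_pm (fun _ => 2 ^ (2 * mSeq s)) g
  have p2 := aux_walshD_pm (fun l => a l / 2 ^ mSeq s)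
    (cubePoint (mSeq s) (fun l => a l % 2 ^ mSeq s))
  unfold walshValD
  rcases p1 with p1 | p1 <;> rcases p2 with p2 | p2 <;> rw [p1, p2] <;> norm_num

lemma aux_mSeq_succ (r : ℕ) : mSeq (r + 2) = 2 * (2 * mSeq (r + 1) + 1) := by
  rw [mSeq]; simp

lemma aux_mSeq_one : mSeq 1 = 0 := by simp [mSeq]

/-- lower rank for stage r -/
def auxLo (r : ℕ) : ℕ := if r = 0 then 0 else 2 * mSeq r + 1

lemma aux_lo_le (r : ℕ) : auxLo r ≤ mSeq (r + 1) := by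
  cases r with
  | zero => simp [auxLo]
  | succ r => rw [aux_mSeq_succ]; simp [auxLo]

lemma aux_lo_mono : Monotone auxLo := by
  apply monotone_nat_of_le_succ
  intro r
  have := aux_lo_le r
  have h2 : auxLo (r + 1) = 2 * mSeq (r + 1) + 1 := by simp [auxLo]
  omega

lemma aux_le_mSeq (r : ℕ) : r ≤ mSeq (r + 1) := by
  induction r with
  | zero => simp
  | succ r ih => rw [aux_mSeq_succ]; omega

lemma aux_Ftil_mem {d r : ℕ} {g : GD d} :
    g ∈ Ftil (idPerm d) r ↔ ∀ t, t < r → g ∈ Fspi (idPerm d) (t + 1) := by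
  simp only [Ftil, Set.mem_iInter, Finset.mem_Icc]
  constructor
  · intro h t ht
    exact h (t + 1) (by omega)
  · intro h t ht
    have := h (t - 1) (by omega)
    rwa [Nat.sub_add_cancel ht.1] at this

lemma aux_Ftil_local {d r k : ℕ} (hk : auxLo r ≤ k) {g h : GD d} (hgh : auxAgree k g h)
    (hg : g ∈ Ftil (idPerm d) r) : h ∈ Ftil (idPerm d) r := by
  rw [aux_Ftil_mem] at hg ⊢
  intro t ht
  refine aux_F_local (fun l u hu => hgh l u ?_) (hg t ht)
  have h1 : auxLo (t + 1) ≤ auxLo r := aux_lo_mono ht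
  have h2 : auxLo (t + 1) = 2 * mSeq (t + 1) + 1 := by simp [auxLo]
  omega

/-- successive correction -/
def auxSeq {d : ℕ} (i : Fin d) (g : GD d) : ℕ → GD d
  | 0 => g
  | n + 1 => if auxSeq i g n ∈ Fspi (idPerm d) (n + 1) then auxSeq i g n
      else auxFlip i (2 * mSeq (n + 1)) (auxSeq i g n)

lemma aux_seq_mem {d : ℕ} (i : Fin d) (g : GD d) (n : ℕ) :
    auxSeq i g (n + 1) ∈ Fspi (idPerm d) (n + 1) := by
  rw [auxSeq]
  split_ifs with h
  · exact h
  · exact (aux_F_toggle i _).mpr h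

lemma aux_seq_step {d : ℕ} (i : Fin d) (g : GD d) (n : ℕ) :
    auxAgree (2 * mSeq (n + 1)) (auxSeq i g n) (auxSeq i g (n + 1)) := by
  rw [auxSeq]
  split_ifs with h
  · exact fun _ _ _ => rfl
  · exact aux_flip_agree _ _ _

lemma aux_hi_mono : Monotone (fun n => 2 * mSeq (n + 1)) := by
  apply monotone_nat_of_le_succ
  intro r
  have := aux_mSeq_succ r
  show 2 * mSeq (r + 1) ≤ 2 * mSeq (r + 2)
  omega

lemma aux_seq_agree {d : ℕ} (i : Fin d) (g : GD d) (n p : ℕ) (hp : n ≤ p) :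
    auxAgree (2 * mSeq (n + 1)) (auxSeq i g n) (auxSeq i g p) := by
  induction p, hp using Nat.le_induction with
  | base => exact fun _ _ _ => rfl
  | succ p hp ih =>
    intro l t ht
    rw [ih l t ht]
    exact aux_seq_step i g p l t (lt_of_lt_of_le ht (aux_hi_mono hp))

lemma aux_seq_stable {d r : ℕ} (i : Fin d) (g : GD d) (hg : g ∈ Ftil (idPerm d) r) :
    ∀ n ≤ r, auxSeq i g n = g := by
  rw [aux_Ftil_mem] at hg
  intro n
  induction n with
  | zero => intro _; rfl
  | succ n ih =>
    intro hn
    rw [auxSeq, ih (by omega), if_pos (hg n (by omega))]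

lemma aux_extend {d r : ℕ} (i : Fin d) (g : GD d) (hg : g ∈ Ftil (idPerm d) r) :
    ∃ h ∈ Fpi (idPerm d), auxAgree (2 * mSeq (r + 1)) g h := by
  let h : GD d := fun l t => auxSeq i g (t + 1) l t
  have hlim : ∀ n, auxAgree (2 * mSeq (n + 1)) (auxSeq i g n) h := by
    intro n l t ht
    rcases le_total n (t + 1) with hn | hn
    · exact aux_seq_agree i g n (t + 1) hn l t ht
    · refine (aux_seq_agree i g (t + 1) n hn l t ?_).symm
      have := aux_le_mSeq (t + 1)
      omega
  refine ⟨h, ?_, ?_⟩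
  · simp only [Fpi, Set.mem_iInter, Set.mem_Ici]
    intro s hs
    obtain ⟨n, rfl⟩ : ∃ n, s = n + 1 := ⟨s - 1, by omega⟩
    refine aux_F_local ?_ (aux_seq_mem i g n)
    intro l t ht
    apply hlim (n + 1) l t
    have := aux_mSeq_succ n
    rw [this]; omega
  · have := hlim r
    rwa [aux_seq_stable i g hg r le_rfl] at this

lemma aux_cubePoint_mem {d : ℕ} (k : ℕ) (m : Fin d → ℕ) : cubePoint k m ∈ dyadicCube k m := by
  intro l t ht
  simp [cubePoint, intervalPoint, ht]

lemma aux_meet {d r k : ℕ} (i : Fin d) (h1 : auxLo r ≤ k) (h2 : k ≤ 2 * mSeq (r + 1))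
    (m : Fin d → ℕ) {g : GD d} (hg : g ∈ dyadicCube k m) :
    (dyadicCube k m ∩ Fpi (idPerm d)).Nonempty ↔ g ∈ Ftil (idPerm d) r := by
  constructor
  · rintro ⟨h, hc, hF⟩
    refine aux_Ftil_local h1 (aux_agree_of_cube m hc hg) ?_
    rw [aux_Ftil_mem]
    intro t _
    simp only [Fpi, Set.mem_iInter, Set.mem_Ici] at hF
    exact hF (t + 1) (by omega)
  · intro hF
    obtain ⟨h, hh, hag⟩ := aux_extend i g hF
    exact ⟨h, aux_cube_agree (fun l t ht => hag l t (by omega)) m hg, hh⟩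

lemma aux_sub {d r k : ℕ} (i : Fin d) (h1 : auxLo r ≤ k) (h2 : k ≤ 2 * mSeq (r + 1))
    (m : Fin d → ℕ) :
    dyadicCube k m ⊆ Ftil (idPerm d) r ↔ (dyadicCube k m ∩ Fpi (idPerm d)).Nonempty := by
  constructor
  · intro h
    exact (aux_meet i h1 h2 m (aux_cubePoint_mem k m)).mpr (h (aux_cubePoint_mem k m))
  · intro h g hg
    exact (aux_meet i h1 h2 m hg).mp h

lemma aux_child_mem {d : ℕ} (k : ℕ) (m : Fin d → ℕ) (σ : Fin d → Fin 2) (g : GD d) :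
    g ∈ dyadicCube (k + 1) (fun l => 2 * m l + (σ l : ℕ)) ↔
      g ∈ dyadicCube k m ∧ ∀ l, g l k = ((σ l : ℕ) : ZMod 2) := by
  simp only [dyadicCube, Set.mem_ofPred_eq]
  rw [← forall_and]
  exact forall_congr' fun l => aux_interval_succ k (m l) _ (σ l).isLt (g l)

/-- the claim at stage `r`, rank `k`. -/
def auxP {d : ℕ} (τ : ℕ → (Fin d → ℕ) → ℂ) (r k : ℕ) : Prop :=
  ∀ m : Fin d → ℕ, (∀ l, m l < 2 ^ k) → (dyadicCube k m ∩ Fpi (idPerm d)).Nonempty →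
    τ k m = (2 : ℂ) ^ r / (2 : ℂ) ^ (d * k)

lemma aux_step {d : ℕ} {τ : ℕ → (Fin d → ℕ) → ℂ}
    (hτ : IsTauOf (Fpi (idPerm d)) τ) (r r' k : ℕ) (hP : auxP τ r k)
    (hcard : ∀ m : Fin d → ℕ, (dyadicCube k m ∩ Fpi (idPerm d)).Nonempty →
      (2 : ℂ) ^ r' * ((Finset.univ.filter fun σ' : Fin d → Fin 2 =>
        (dyadicCube (k + 1) (fun l => 2 * m l + (σ' l : ℕ)) ∩ Fpi (idPerm d)).Nonempty).card : ℂ)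
        = 2 ^ r * 2 ^ d) : auxP τ r' (k + 1) := by
  intro m hm hne
  obtain ⟨_, _, _, h4⟩ := hτ
  let p : Fin d → ℕ := fun l => m l / 2
  let σ : Fin d → Fin 2 := fun l => ⟨m l % 2, Nat.mod_lt _ (by norm_num)⟩
  have hmp : m = fun l => 2 * p l + (σ l : ℕ) := by
    funext l
    simp only [p, σ]
    omega
  have hp : ∀ l, p l < 2 ^ k := by
    intro l
    have := hm l
    rw [pow_succ] at this
    simp only [p]
    omega
  rw [hmp] at hne ⊢
  have hpne : (dyadicCube k p ∩ Fpi (idPerm d)).Nonempty := by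
    obtain ⟨g, hg, hF⟩ := hne
    exact ⟨g, ((aux_child_mem k p σ g).mp hg).1, hF⟩
  rw [h4 k p hp hpne σ, if_pos hne, hP p hp hpne]
  have hc := hcard p hpne
  generalize hC : ((Finset.univ.filter fun σ' : Fin d → Fin 2 =>
        (dyadicCube (k + 1) (fun l => 2 * p l + (σ' l : ℕ)) ∩ Fpi (idPerm d)).Nonempty).card : ℂ)
        = C at hc ⊢
  have hC0 : C ≠ 0 := by
    rintro rfl
    rw [mul_zero] at hc
    exact (mul_ne_zero (pow_ne_zero r two_ne_zero) (pow_ne_zero d two_ne_zero)) hc.symm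
  have e : (2 : ℂ) ^ (d * (k + 1)) = 2 ^ (d * k) * 2 ^ d := by rw [mul_add, mul_one, pow_add]
  rw [e, div_div, div_eq_div_iff (mul_ne_zero (pow_ne_zero _ two_ne_zero) hC0)
    (mul_ne_zero (pow_ne_zero _ two_ne_zero) (pow_ne_zero _ two_ne_zero))]
  linear_combination (-(2 : ℂ) ^ (d * k)) * hc

lemma aux_step_same {d : ℕ} (i : Fin d) {τ : ℕ → (Fin d → ℕ) → ℂ}
    (hτ : IsTauOf (Fpi (idPerm d)) τ) (r k : ℕ) (h1 : auxLo r ≤ k)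
    (h2 : k + 1 ≤ 2 * mSeq (r + 1)) (hP : auxP τ r k) : auxP τ r (k + 1) := by
  refine aux_step hτ r r k hP ?_
  intro m hne
  rw [Finset.filter_true_of_mem]
  · simp
  · intro σ _
    rw [← aux_sub i (by omega) h2]
    intro g hg
    exact (aux_sub i h1 (by omega) m).mpr hne ((aux_child_mem k m σ g).mp hg).1

lemma aux_step_next {d : ℕ} (i : Fin d) {τ : ℕ → (Fin d → ℕ) → ℂ}
    (hτ : IsTauOf (Fpi (idPerm d)) τ) (r : ℕ)
    (hP : auxP τ r (2 * mSeq (r + 1))) : auxP τ (r + 1) (2 * mSeq (r + 1) + 1) := by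
  refine aux_step hτ r (r + 1) _ hP ?_
  intro m hne
  set k := 2 * mSeq (r + 1) with hk
  have hlo : auxLo r ≤ k := by have := aux_lo_le r; omega
  have hlo' : auxLo (r + 1) ≤ k + 1 := by simp [auxLo, hk]
  have hhi' : k + 1 ≤ 2 * mSeq (r + 1 + 1) := by rw [aux_mSeq_succ]; omega
  have hpar := (aux_sub i hlo le_rfl m).mpr hne
  -- criterion for children
  have crit : ∀ (σ : Fin d → Fin 2) (g : GD d),
      g ∈ dyadicCube (k + 1) (fun l => 2 * m l + (σ l : ℕ)) →
      ((dyadicCube (k + 1) (fun l => 2 * m l + (σ l : ℕ)) ∩ Fpi (idPerm d)).Nonempty ↔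
        g ∈ Fspi (idPerm d) (r + 1)) := by
    intro σ g hg
    rw [aux_meet i hlo' hhi' _ hg, aux_Ftil_mem]
    have hgp := hpar ((aux_child_mem k m σ g).mp hg).1
    rw [aux_Ftil_mem] at hgp
    constructor
    · intro h; exact h r (by omega)
    · intro h t ht
      rcases Nat.lt_succ_iff_lt_or_eq.mp ht with h' | h'
      · exact hgp t h'
      · subst h'; exact h
  let fl : (Fin d → Fin 2) → (Fin d → Fin 2) := fun σ l => if l = i then σ l + 1 else σ l
  have f2 : ∀ x : Fin 2, x + 1 + 1 = x := by decide
  have flfl : ∀ σ, fl (fl σ) = σ := by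
    intro σ; funext l
    by_cases h : l = i <;> simp [fl, h, f2]
  have hcast : ∀ x : Fin 2, (((x + 1 : Fin 2) : ℕ) : ZMod 2) = ((x : ℕ) : ZMod 2) + 1 := by decide
  have htog : ∀ σ : Fin d → Fin 2,
      ((dyadicCube (k + 1) (fun l => 2 * m l + (fl σ l : ℕ)) ∩ Fpi (idPerm d)).Nonempty ↔
       ¬ (dyadicCube (k + 1) (fun l => 2 * m l + (σ l : ℕ)) ∩ Fpi (idPerm d)).Nonempty) := by
    intro σ
    have hg := aux_cubePoint_mem (k + 1) (fun l => 2 * m l + (σ l : ℕ))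
    set g := cubePoint (k + 1) (fun l => 2 * m l + (σ l : ℕ))
    have hg' : auxFlip i k g ∈ dyadicCube (k + 1) (fun l => 2 * m l + (fl σ l : ℕ)) := by
      have hh := (aux_child_mem k m σ g).mp hg
      rw [aux_child_mem]
      refine ⟨aux_cube_agree (aux_flip_agree i k g) m hh.1, fun l => ?_⟩
      by_cases h : l = i
      · simp only [auxFlip, fl, h, and_self, if_true]
        rw [hcast, hh.2]
      · simp only [auxFlip, fl, h, false_and, if_false]
        exact hh.2 l
    rw [crit σ g hg, crit (fl σ) _ hg']
    exact aux_F_toggle i g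
  have hbij : (Finset.univ.filter fun σ' : Fin d → Fin 2 =>
        (dyadicCube (k + 1) (fun l => 2 * m l + (σ' l : ℕ)) ∩ Fpi (idPerm d)).Nonempty).card =
      (Finset.univ.filter fun σ' : Fin d → Fin 2 =>
        ¬ (dyadicCube (k + 1) (fun l => 2 * m l + (σ' l : ℕ)) ∩ Fpi (idPerm d)).Nonempty).card := by
    refine Finset.card_bij' (fun σ _ => fl σ) (fun σ _ => fl σ) ?_ ?_ ?_ ?_
    · intro σ hσ
      simp only [Finset.mem_filter, Finset.mem_univ, true_and] at hσ ⊢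
      rw [htog, not_not]; exact hσ
    · intro σ hσ
      simp only [Finset.mem_filter, Finset.mem_univ, true_and] at hσ ⊢
      rw [htog]; exact hσ
    · intro σ _; exact flfl σ
    · intro σ _; exact flfl σ
  have htot := Finset.card_filter_add_card_filter_not (s := (Finset.univ : Finset (Fin d → Fin 2)))
    (fun σ' : Fin d → Fin 2 =>
        (dyadicCube (k + 1) (fun l => 2 * m l + (σ' l : ℕ)) ∩ Fpi (idPerm d)).Nonempty)
  rw [← hbij] at htot
  have hu : (Finset.univ : Finset (Fin d → Fin 2)).card = 2 ^ d := by simp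
  rw [hu] at htot
  have htot' := congrArg (Nat.cast : ℕ → ℂ) htot
  push_cast at htot'
  rw [pow_succ, ← htot']
  ring

lemma aux_main {d : ℕ} (i : Fin d) {τ : ℕ → (Fin d → ℕ) → ℂ}
    (hτ : IsTauOf (Fpi (idPerm d)) τ) (r : ℕ) :
    ∀ k, auxLo r ≤ k → k ≤ 2 * mSeq (r + 1) → auxP τ r k := by
  have inner : ∀ r, auxP τ r (auxLo r) → ∀ k, auxLo r ≤ k → k ≤ 2 * mSeq (r + 1) → auxP τ r k := by
    intro r h0 k hk
    induction k, hk using Nat.le_induction with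
    | base => intro _; exact h0
    | succ k hk ih =>
      intro h
      exact aux_step_same i hτ r k hk h (ih (by omega))
  induction r with
  | zero =>
    apply inner
    intro m hm _
    have h0 : auxLo 0 = 0 := by simp [auxLo]
    rw [h0] at hm ⊢
    have : m = fun _ => 0 := by
      funext l
      have := hm l
      simpa using this
    rw [this, hτ.2.1]
    simp
  | succ r ih =>
    apply inner
    have h0 : auxLo (r + 1) = 2 * mSeq (r + 1) + 1 := by simp [auxLo]
    rw [h0]
    apply aux_step_next i hτ r
    apply ih _ _ le_rfl
    have := aux_lo_le r
    omega

lemma aux_final {d : ℕ} (i : Fin d) {τ : ℕ → (Fin d → ℕ) → ℂ}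
    (hτ : IsTauOf (Fpi (idPerm d)) τ) (r k : ℕ) (h1 : auxLo r ≤ k) (h2 : k ≤ 2 * mSeq (r + 1))
    (m : Fin d → ℕ) (hm : ∀ l, m l < 2 ^ k) :
    τ k m = if dyadicCube k m ⊆ Ftil (idPerm d) r then
          (2 : ℂ) ^ r / (2 : ℂ) ^ (d * k) else 0 := by
  split_ifs with h
  · exact aux_main i hτ r k h1 h2 m hm ((aux_sub i h1 h2 m).mp h)
  · rw [aux_sub i h1 h2, Set.not_nonempty_iff_eq_empty] at h
    exact (hτ.2.2.1 k m hm).mpr h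

/-- values of `τ_F` on dyadic cubes of ranks `m_s` and `2m_s+1`:
`τ(Δ^{(m_s)}) = 2^{s−1−d·m_s}` if `Δ ⊆ F̃_{s−1}` and `0` otherwise;
`τ(Δ^{(2m_s+1)}) = 2^{s−d(2m_s+1)}` if `Δ ⊆ F̃_s` and `0` otherwise. -/
theorem statement7 (d : ℕ) (hd : 2 ≤ d) (τ : ℕ → (Fin d → ℕ) → ℂ)
    (hτ : IsTauOf (Fpi (idPerm d)) τ) (s : ℕ) (hs : 1 ≤ s) :
    (∀ m : Fin d → ℕ, (∀ l, m l < 2 ^ mSeq s) →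
      τ (mSeq s) m =
        if dyadicCube (mSeq s) m ⊆ Ftil (idPerm d) (s - 1) then
          (2 : ℂ) ^ (s - 1) / (2 : ℂ) ^ (d * mSeq s)
        else 0) ∧
    (∀ m : Fin d → ℕ, (∀ l, m l < 2 ^ (2 * mSeq s + 1)) →
      τ (2 * mSeq s + 1) m =
        if dyadicCube (2 * mSeq s + 1) m ⊆ Ftil (idPerm d) s then
          (2 : ℂ) ^ s / (2 : ℂ) ^ (d * (2 * mSeq s + 1))
        else 0) := by
  obtain ⟨r, rfl⟩ : ∃ r, s = r + 1 := ⟨s - 1, by omega⟩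
  have i : Fin d := ⟨0, by omega⟩
  have h1 := aux_lo_le r
  refine ⟨fun m hm => ?_, fun m hm => ?_⟩
  · exact aux_final i hτ r _ h1 (by omega) m hm
  · refine aux_final i hτ (r + 1) _ (by simp [auxLo]) ?_ m hm
    rw [aux_mSeq_succ]; omega
end
end

section
/- Let τ = τ_F, let s ≥ 1, and let 𝐧 = 2^{2m_s}𝟏 + 2^{m_s}𝐩 + 𝐪 with 𝐩, 𝐪 ∈ {0,…,2^{m_s}−1}^d. Then for every 𝐦 ∈ {0,…,2^{m_s}−1}^d the local coefficient satisfies τ̂_𝐧(Δ^{(m_s)}_𝐦) = 2^{s−1−d·m_s} · W^{(m_s)}_{𝐪𝐦} if 𝐦 = 𝐩 and Δ^{(m_s)}_𝐦 ⊆ F̃_{s−1}, and τ̂_𝐧(Δ^{(m_s)}_𝐦) = 0 otherwise. Consequently, the Fourier–Walsh coefficient satisfies τ̂_𝐧 = 2^{s−1−d·m_s} · W^{(m_s)}_{𝐪𝐩} if Δ^{(m_s)}_𝐩 ⊆ F̃_{s−1}, and τ̂_𝐧 = 0 otherwise. -/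
open Filter Finset Topology MeasureTheory
open scoped Classical

noncomputable section

/-- sign pairing -/
def eps (u v : ZMod 2) : ℝ := if u = 1 ∧ v = 1 then -1 else 1

/-- binary digit as an element of `ZMod 2` -/
def bt (n t : ℕ) : ZMod 2 := if n.testBit t then 1 else 0

/-- agreement of the first `k` digits -/
def Agree {d : ℕ} (k : ℕ) (g h : GD d) : Prop := ∀ l, ∀ t < k, g l t = h l t

lemma zmod_cases (v : ZMod 2) : v = 0 ∨ v = 1 := by
  revert v; decide

lemma bt_eq_one (n t : ℕ) : bt n t = 1 ↔ n.testBit t = true := by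
  unfold bt; split <;> simp_all

lemma bt_inj (a b t : ℕ) (h : bt a t = bt b t) : a.testBit t = b.testBit t := by
  have h1 := bt_eq_one a t
  have h2 := bt_eq_one b t
  rw [h, h2] at h1
  rw [Bool.eq_iff_iff]; exact h1.symm

lemma Agree.symm {d k : ℕ} {g h : GD d} (H : Agree k g h) : Agree k h g :=
  fun l t ht => (H l t ht).symm

lemma Agree.trans {d k : ℕ} {g h i : GD d} (H : Agree k g h) (H' : Agree k h i) : Agree k g i :=
  fun l t ht => (H l t ht).trans (H' l t ht)

lemma Agree.mono {d k r : ℕ} {g h : GD d} (H : Agree k g h) (hr : r ≤ k) : Agree r g h :=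
  fun l t ht => H l t (ht.trans_le hr)

lemma Agree.refl {d : ℕ} (k : ℕ) (g : GD d) : Agree k g g := fun _ _ _ => rfl

lemma point_lt {k m t : ℕ} (ht : t < k) : intervalPoint k m t = bt m (k - 1 - t) := by
  simp [intervalPoint, bt, ht]

lemma mem_interval {k m : ℕ} {g : DyadicGroup} :
    g ∈ dyadicInterval k m ↔ ∀ t < k, g t = bt m (k - 1 - t) := Iff.rfl

lemma mem_cube {d k : ℕ} {m : Fin d → ℕ} {g : GD d} :
    g ∈ dyadicCube k m ↔ Agree k g (cubePoint k m) := by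
  constructor
  · intro h l t ht
    rw [cubePoint, point_lt ht]; exact h l t ht
  · intro h l t ht
    have := h l t ht
    rw [cubePoint, point_lt ht] at this; exact this

lemma cube_sub {d k r : ℕ} (hr : r ≤ k) {x m : Fin d → ℕ} :
    dyadicCube k x ⊆ dyadicCube r m ↔ Agree r (cubePoint k x) (cubePoint r m) := by
  constructor
  · intro h
    exact mem_cube.1 (h (mem_cube.2 (Agree.refl _ _)))
  · intro h g hg
    exact mem_cube.2 (((mem_cube.1 hg).mono hr).trans h)

lemma point_inj {k a b : ℕ} (ha : a < 2 ^ k) (hb : b < 2 ^ k)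
    (h : ∀ t < k, intervalPoint k a t = intervalPoint k b t) : a = b := by
  apply Nat.eq_of_testBit_eq
  intro i
  by_cases hi : i < k
  · have := h (k - 1 - i) (by omega)
    rw [point_lt (by omega), point_lt (by omega)] at this
    have e : k - 1 - (k - 1 - i) = i := by omega
    rw [e] at this
    exact bt_inj _ _ _ this
  · have h2 : 2 ^ k ≤ 2 ^ i := Nat.pow_le_pow_right (by norm_num) (by omega)
    rw [Nat.testBit_lt_two_pow (ha.trans_le h2), Nat.testBit_lt_two_pow (hb.trans_le h2)]

lemma point_child_lt {k m b t : ℕ} (hb : b < 2) (ht : t < k) :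
    intervalPoint (k + 1) (2 * m + b) t = intervalPoint k m t := by
  rw [point_lt ht, point_lt (by omega)]
  have e : k + 1 - 1 - t = (k - 1 - t) + 1 := by omega
  rw [e, bt, bt, Nat.testBit_succ]
  have : (2 * m + b) / 2 = m := by omega
  rw [this]

lemma point_child_eq {k m b : ℕ} (hb : b < 2) :
    intervalPoint (k + 1) (2 * m + b) k = (b : ZMod 2) := by
  rw [point_lt (by omega)]
  have e : k + 1 - 1 - k = 0 := by omega
  rw [e, bt, Nat.testBit_zero]
  interval_cases b
  · simp
  · simp [Nat.add_mod]

lemma exists_point (k : ℕ) (g : DyadicGroup) :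
    ∃ m < 2 ^ k, ∀ t < k, g t = intervalPoint k m t := by
  induction k with
  | zero => exact ⟨0, by simp, by simp⟩
  | succ k ih =>
    obtain ⟨m, hm, h⟩ := ih
    have key : ∃ b < 2, g k = ((b : ℕ) : ZMod 2) := by
      rcases zmod_cases (g k) with h | h
      · exact ⟨0, by norm_num, by simp [h]⟩
      · exact ⟨1, by norm_num, by simp [h]⟩
    obtain ⟨b, hb, hgb⟩ := key
    refine ⟨2 * m + b, by rw [pow_succ]; omega, fun t ht => ?_⟩
    rcases Nat.lt_succ_iff_lt_or_eq.1 ht with ht | rfl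
    · rw [point_child_lt hb ht, h t ht]
    · rw [point_child_eq hb, hgb]

lemma walsh_eq {n K : ℕ} (hn : n < 2 ^ K) (g : DyadicGroup) :
    walsh n g = ∏ t ∈ range K, eps (bt n t) (g t) := by
  have h1 : walsh n g = ∏ t ∈ range n, eps (bt n t) (g t) := by
    unfold walsh
    refine prod_congr rfl fun t _ => ?_
    simp only [eps, bt_eq_one]
  have key : ∀ t, n < 2 ^ t → eps (bt n t) (g t) = 1 := by
    intro t ht
    simp [eps, bt, Nat.testBit_lt_two_pow ht]
  have h3 : ∀ A ≤ max n K, n < 2 ^ A → ∏ t ∈ range A, eps (bt n t) (g t)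
      = ∏ t ∈ range (max n K), eps (bt n t) (g t) := by
    intro A hA hnA
    apply prod_subset
    · intro t; simp only [Finset.mem_range]; omega
    · intro t _ ht
      apply key
      simp only [Finset.mem_range] at ht
      exact hnA.trans_le (Nat.pow_le_pow_right (by norm_num) (by omega))
  rw [h1, h3 n (le_max_left _ _) Nat.lt_two_pow_self, h3 K (le_max_right _ _) hn]

lemma walsh_two_pow (K : ℕ) (g : DyadicGroup) : walsh (2 ^ K) g = eps 1 (g K) := by
  rw [walsh_eq (K := K + 1) (Nat.pow_lt_pow_right (by norm_num) (by omega)), prod_range_succ,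
    prod_eq_one, one_mul]
  · simp [bt]
  · intro t ht
    simp only [Finset.mem_range] at ht
    have : ¬ (K = t) := by omega
    simp [eps, bt, this]

/-- the quadratic form -/
def Qf (M : ℕ) (g : DyadicGroup) : ℝ := ∏ t ∈ range M, eps (g (M - 1 - t)) (g (M + t))

lemma walsh_split {M p q : ℕ} (hp : p < 2 ^ M) (hq : q < 2 ^ M) (g : DyadicGroup) :
    walsh (2 ^ (2 * M) + 2 ^ M * p + q) g =
      ((∏ t ∈ range M, eps (bt q t) (g t)) * ∏ t ∈ range M, eps (bt p t) (g (M + t)))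
        * eps 1 (g (2 * M)) := by
  have hn : 2 ^ (2 * M) + 2 ^ M * p + q = 2 ^ M * (2 ^ M + p) + q := by
    rw [two_mul, pow_add]; ring
  have hlt : 2 ^ (2 * M) + 2 ^ M * p + q < 2 ^ (2 * M + 1) := by
    have : 2 ^ M * p + q < 2 ^ (2 * M) := by
      rw [two_mul, pow_add]; nlinarith
    rw [pow_succ]; omega
  rw [walsh_eq hlt, hn, prod_range_succ, two_mul, prod_range_add]
  have hb : ∀ j, bt (2 ^ M * (2 ^ M + p) + q) j = if j < M then bt q j else bt (2 ^ M + p) (j - M) := by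
    intro j
    simp only [bt, Nat.testBit_two_pow_mul_add _ hq]
    split <;> rfl
  congr 1
  · congr 1
    · refine prod_congr rfl fun t ht => ?_
      rw [hb, if_pos (Finset.mem_range.1 ht)]
    · refine prod_congr rfl fun t ht => ?_
      have ht := Finset.mem_range.1 ht
      rw [hb, if_neg (by omega), Nat.add_sub_cancel_left]
      congr 1
      simp only [bt]
      rw [Nat.testBit_two_pow_add_gt ht]
  · rw [hb, if_neg (by omega), Nat.add_sub_cancel_left]
    congr 1
    simp [bt, Nat.testBit_two_pow_add_eq, Nat.testBit_lt_two_pow hp]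

/-- the condition defining `F_s` -/
def Cond {d : ℕ} (M : ℕ) (g : GD d) : Prop := ∏ l, eps 1 (g l (2 * M)) = ∏ l, Qf M (g l)

lemma Qf_congr {M : ℕ} {g h : DyadicGroup} (H : ∀ t < 2 * M, g t = h t) : Qf M g = Qf M h := by
  refine prod_congr rfl fun t ht => ?_
  have ht := Finset.mem_range.1 ht
  rw [H _ (by omega), H _ (by omega)]

lemma Cond_congr {d M : ℕ} {g h : GD d} (H : Agree (2 * M + 1) g h) : Cond M g ↔ Cond M h := by
  unfold Cond
  have h1 : ∀ l, g l (2 * M) = h l (2 * M) := fun l => H l _ (by omega)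
  have h2 : ∀ l, Qf M (g l) = Qf M (h l) := fun l => Qf_congr fun t ht => H l t (by omega)
  simp only [h1, h2]

lemma walshVal_eq_Qf {M a b : ℕ} (ha : a < 2 ^ M) (hb : b < 2 ^ M) {g : DyadicGroup}
    (hg : g ∈ dyadicInterval (2 * M) (2 ^ M * a + b)) : walsh a (intervalPoint M b) = Qf M g := by
  rw [walsh_eq ha]
  refine prod_congr rfl fun t ht => ?_
  have ht := Finset.mem_range.1 ht
  rw [mem_interval] at hg
  rw [hg _ (by omega), hg _ (by omega), point_lt ht]
  congr 1
  · have e : 2 * M - 1 - (M - 1 - t) = M + t := by omega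
    simp only [e, bt, Nat.testBit_two_pow_mul_add _ hb]
    rw [if_neg (show ¬ (M + t < M) by omega), Nat.add_sub_cancel_left]
  · have e : 2 * M - 1 - (M + t) = M - 1 - t := by omega
    simp only [e, bt, Nat.testBit_two_pow_mul_add _ hb]
    rw [if_pos (show M - 1 - t < M by omega)]

lemma mem_box {d k : ℕ} {m : Fin d → ℕ} : m ∈ box d k ↔ ∀ l, m l < 2 ^ k := Iff.rfl

lemma mem_Fspi {d s : ℕ} {g : GD d} : g ∈ Fspi (idPerm d) s ↔ Cond (mSeq s) g := by
  simp only [Fspi, Set.mem_iUnion, Set.mem_ofPred_eq, idPerm, exists_prop, mem_box]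
  unfold walshValD walshD cubePoint Cond
  simp only [walsh_two_pow]
  constructor
  · rintro ⟨m, hm, m', hm', hg, h⟩
    rw [h]
    exact prod_congr rfl fun l _ => walshVal_eq_Qf (hm l) (hm' l) (hg l)
  · intro h
    choose x hx hgx using fun l => exists_point (2 * mSeq s) (g l)
    have hd : ∀ l, 2 ^ mSeq s * (x l / 2 ^ mSeq s) + x l % 2 ^ mSeq s = x l :=
      fun l => Nat.div_add_mod _ _
    have hm : ∀ l, x l / 2 ^ mSeq s < 2 ^ mSeq s := fun l => by
      rw [Nat.div_lt_iff_lt_mul (by positivity), ← pow_add, ← two_mul]; exact hx l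
    have hm' : ∀ l, x l % 2 ^ mSeq s < 2 ^ mSeq s := fun l => Nat.mod_lt _ (by positivity)
    have hc : g ∈ dyadicCube (2 * mSeq s)
        (fun l => 2 ^ mSeq s * (x l / 2 ^ mSeq s) + x l % 2 ^ mSeq s) := by
      simp only [hd]
      exact mem_cube.2 fun l t ht => hgx l t ht
    refine ⟨fun l => x l / 2 ^ mSeq s, hm, fun l => x l % 2 ^ mSeq s, hm', hc, ?_⟩
    rw [h]
    exact prod_congr rfl fun l _ => (walshVal_eq_Qf (hm l) (hm' l) (hc l)).symm

/-- all conditions visible at rank `k` hold -/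
def Good {d : ℕ} (k : ℕ) (g : GD d) : Prop := ∀ s, 1 ≤ s → 2 * mSeq s < k → Cond (mSeq s) g

lemma Good_congr {d k : ℕ} {g h : GD d} (H : Agree k g h) : Good k g ↔ Good k h := by
  unfold Good
  refine forall_congr' fun s => forall_congr' fun _ => forall_congr' fun hk => ?_
  exact Cond_congr (H.mono hk)

lemma Good.mono {d k r : ℕ} {g : GD d} (h : Good k g) (hr : r ≤ k) : Good r g :=
  fun s hs hk => h s hs (hk.trans_le hr)

lemma mem_Fpi {d : ℕ} {g : GD d} : g ∈ Fpi (idPerm d) ↔ ∀ k, Good k g := by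
  simp only [Fpi, Set.mem_iInter, mem_Fspi, Set.mem_Ici, Good]
  exact ⟨fun h k s hs _ => h s hs, fun h s hs => h (2 * mSeq s + 1) s hs (by omega)⟩

lemma mSeq_succ {s : ℕ} (hs : 1 ≤ s) : mSeq (s + 1) = 2 * (2 * mSeq s + 1) := by
  rw [mSeq, if_neg (by omega)]

lemma mSeq_lt {s r : ℕ} (hs : 1 ≤ s) (h : s < r) : 2 * mSeq s < mSeq r := by
  induction r with
  | zero => omega
  | succ r ih =>
    rw [mSeq_succ (by omega)]
    rcases Nat.lt_succ_iff_lt_or_eq.1 h with h | rfl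
    · have := ih h; omega
    · omega

lemma lt_of_mSeq_lt {s r : ℕ} (hr : 1 ≤ r) (h : mSeq s < mSeq r) : s < r := by
  by_contra hc
  rcases Nat.lt_or_ge r s with h1 | h1
  · have := mSeq_lt hr h1; omega
  · have : r = s := by omega
    subst this; omega

lemma mSeq_inj {s r : ℕ} (hs : 1 ≤ s) (hr : 1 ≤ r) (h : mSeq s = mSeq r) : s = r := by
  rcases Nat.lt_trichotomy s r with h1 | h1 | h1
  · have := mSeq_lt hs h1; omega
  · exact h1
  · have := mSeq_lt hr h1; omega

lemma eps_cases (u v : ZMod 2) : eps u v = 1 ∨ eps u v = -1 := by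
  unfold eps; split <;> simp

lemma prod_cases {ι : Type*} (S : Finset ι) (f : ι → ℝ) (h : ∀ i, f i = 1 ∨ f i = -1) :
    ∏ i ∈ S, f i = 1 ∨ ∏ i ∈ S, f i = -1 := by
  induction S using Finset.induction_on with
  | empty => simp
  | insert a S ha ih =>
    rw [prod_insert ha]
    rcases h a with h | h <;> rcases ih with ih | ih <;> simp [h, ih]

lemma Qf_cases {d M : ℕ} (g : GD d) : ∏ l, Qf M (g l) = 1 ∨ ∏ l, Qf M (g l) = -1 :=
  prod_cases _ _ fun _ => prod_cases _ _ fun _ => eps_cases _ _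

lemma good_step {d : ℕ} (hd : 2 ≤ d) (k : ℕ) (g : GD d) :
    ∃ g' : GD d, Agree k g g' ∧ (Good k g → Good (k + 1) g') := by
  by_cases hk : ∃ s, 1 ≤ s ∧ 2 * mSeq s = k
  · obtain ⟨s, hs, hsk⟩ := hk
    let l0 : Fin d := ⟨0, by omega⟩
    let a : ZMod 2 := if ∏ l, Qf (mSeq s) (g l) = 1 then 0 else 1
    let g' : GD d := fun l t => if t = k then (if l = l0 then a else 0) else g l t
    have hA : Agree k g g' := fun l t ht => by
      simp only [g']; rw [if_neg (by omega)]
    refine ⟨g', hA, fun hg r hr hrk => ?_⟩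
    by_cases hlt : 2 * mSeq r < k
    · exact (Cond_congr (hA.mono hlt)).1 (hg r hr hlt)
    · have : r = s := mSeq_inj hr hs (by omega)
      subst this
      unfold Cond
      have h2 : ∀ l, Qf (mSeq r) (g' l) = Qf (mSeq r) (g l) :=
        fun l => Qf_congr fun t ht => (hA l t (by omega)).symm
      simp only [h2]
      have h3 : ∏ l, eps 1 (g' l (2 * mSeq r)) = eps 1 a := by
        rw [Finset.prod_eq_single l0]
        · simp [g', hsk]
        · intro b _ hb; simp [g', hsk, hb, eps]
        · simp
      rw [h3]
      rcases Qf_cases (M := mSeq r) g with h | h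
      · simp [a, h, eps]
      · have : ¬ ((-1 : ℝ) = 1) := by norm_num
        simp [a, h, eps, this]
  · refine ⟨g, Agree.refl _ _, fun hg s hs hlt => hg s hs ?_⟩
    have : ¬ 2 * mSeq s = k := fun h => hk ⟨s, hs, h⟩
    omega

lemma good_ext {d : ℕ} (hd : 2 ≤ d) (k : ℕ) (g : GD d) (hg : Good k g) :
    ∃ g' ∈ Fpi (idPerm d), Agree k g g' := by
  choose f hf1 hf2 using fun k g => good_step hd k g
  let H : ℕ → GD d := fun j => Nat.rec g (fun i h => f (k + i) h) j
  have H0 : H 0 = g := rfl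
  have HS : ∀ i, H (i + 1) = f (k + i) (H i) := fun i => rfl
  have HG : ∀ i, Good (k + i) (H i) := by
    intro i
    induction i with
    | zero => exact hg
    | succ i ih => rw [HS]; exact hf2 _ _ ih
  have HA : ∀ i j, Agree (k + i) (H i) (H (i + j)) := by
    intro i j
    induction j with
    | zero => exact Agree.refl _ _
    | succ j ih =>
      refine ih.trans ?_
      rw [← Nat.add_assoc, HS]
      exact (hf1 _ _).mono (by omega)
  let g' : GD d := fun l t => H (t + 1) l t
  have hA' : ∀ j, Agree (k + j) (H j) g' := by
    intro j l t ht
    rcases Nat.le_total j (t + 1) with h | h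
    · obtain ⟨i, hi⟩ := Nat.exists_eq_add_of_le h
      have := HA j i l t ht
      simp only [g']; rw [hi]; exact this
    · obtain ⟨i, hi⟩ := Nat.exists_eq_add_of_le h
      have := HA (t + 1) i l t (by omega)
      simp only [g']; rw [hi]; exact this.symm
  refine ⟨g', mem_Fpi.2 fun j => ?_, hA' 0⟩
  exact ((Good_congr (hA' j)).1 (HG j)).mono (by omega)

lemma meets_iff {d : ℕ} (hd : 2 ≤ d) (k : ℕ) (m : Fin d → ℕ) :
    (dyadicCube k m ∩ Fpi (idPerm d)).Nonempty ↔ Good k (cubePoint k m) := by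
  constructor
  · rintro ⟨g, hg, hF⟩
    exact (Good_congr (mem_cube.1 hg)).1 (mem_Fpi.1 hF k)
  · intro h
    obtain ⟨g', hF, hA⟩ := good_ext hd k _ h
    exact ⟨g', mem_cube.2 hA.symm, hF⟩

lemma child_agree {d k : ℕ} (m : Fin d → ℕ) (σ : Fin d → Fin 2) :
    Agree k (cubePoint (k + 1) (fun l => 2 * m l + (σ l : ℕ))) (cubePoint k m) :=
  fun l _ ht => point_child_lt (σ l).isLt ht

lemma count_half {d : ℕ} (hd : 2 ≤ d) (c : ℝ) (hc : c = 1 ∨ c = -1) :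
    (((Finset.univ : Finset (Fin d → Fin 2)).filter
      fun σ => ∏ l, eps 1 ((σ l : ℕ) : ZMod 2) = c).card : ℂ) = 2 ^ d / 2 := by
  have h1 : (((Finset.univ : Finset (Fin d → Fin 2)).filter
      fun σ => ∏ l, eps 1 ((σ l : ℕ) : ZMod 2) = c).card : ℝ) = 2 ^ d / 2 := by
    rw [Finset.card_filter]
    push_cast
    have h2 : ∀ σ : Fin d → Fin 2, (if ∏ l, eps 1 ((σ l : ℕ) : ZMod 2) = c then (1 : ℝ) else 0)
        = (1 + c * ∏ l, eps 1 ((σ l : ℕ) : ZMod 2)) / 2 := by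
      intro σ
      rcases prod_cases univ (fun l => eps 1 ((σ l : ℕ) : ZMod 2)) (fun _ => eps_cases _ _) with h | h
        <;> rcases hc with rfl | rfl <;> rw [h] <;> norm_num
    rw [Finset.sum_congr rfl fun σ _ => h2 σ, ← Finset.sum_div, Finset.sum_add_distrib,
      ← Finset.mul_sum]
    have h3 : ∑ σ : Fin d → Fin 2, ∏ l, eps 1 ((σ l : ℕ) : ZMod 2) = 0 := by
      have := Finset.prod_univ_sum (fun _ : Fin d => (Finset.univ : Finset (Fin 2)))
        (fun _ b => eps 1 ((b : ℕ) : ZMod 2))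
      rw [Fintype.piFinset_univ] at this
      rw [← this]
      apply Finset.prod_eq_zero (Finset.mem_univ (⟨0, by omega⟩ : Fin d))
      simp [Fin.sum_univ_two, eps]
    rw [h3]; simp
  have h4 := congrArg (fun x : ℝ => (x : ℂ)) h1
  simp only [Complex.ofReal_natCast, Complex.ofReal_div, Complex.ofReal_pow,
    Complex.ofReal_ofNat] at h4
  exact h4

/-- number of conditions visible at rank `k` -/
def Nc : ℕ → ℕ
  | 0 => 0
  | k + 1 => Nc k + if ∃ s, 1 ≤ s ∧ 2 * mSeq s = k then 1 else 0

lemma Nc_val (s : ℕ) (hs : 1 ≤ s) : Nc (2 * mSeq s) = s - 1 := by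
  induction s, hs using Nat.le_induction with
  | base => simp [mSeq, Nc]
  | succ s hs ih =>
    have key : ∀ j, 2 * mSeq s + 1 + j ≤ 2 * mSeq (s + 1) → Nc (2 * mSeq s + 1 + j) = s := by
      intro j
      induction j with
      | zero =>
        intro _
        rw [Nat.add_zero, Nc, if_pos ⟨s, hs, rfl⟩, ih]; omega
      | succ j ihj =>
        intro h
        rw [← Nat.add_assoc, Nc, ihj (by omega), if_neg, Nat.add_zero]
        rintro ⟨r, hr, hrk⟩
        have h1 : r < s + 1 := lt_of_mSeq_lt (by omega) (by omega)
        have h2 : s < r := lt_of_mSeq_lt hr (by omega)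
        omega
    have h0 : mSeq (s + 1) = 2 * (2 * mSeq s + 1) := mSeq_succ hs
    have := key (2 * mSeq (s + 1) - (2 * mSeq s + 1)) (by omega)
    rw [show 2 * mSeq s + 1 + (2 * mSeq (s + 1) - (2 * mSeq s + 1)) = 2 * mSeq (s + 1) by omega] at this
    rw [this]; omega

lemma good_child {d k : ℕ} (m : Fin d → ℕ) (hg : Good k (cubePoint k m)) (σ : Fin d → Fin 2)
    (s : ℕ) (hs : 1 ≤ s) (hk : 2 * mSeq s = k) :
    Good (k + 1) (cubePoint (k + 1) (fun l => 2 * m l + (σ l : ℕ))) ↔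
      ∏ l, eps 1 ((σ l : ℕ) : ZMod 2) = ∏ l, Qf (mSeq s) (cubePoint k m l) := by
  have hC : Cond (mSeq s) (cubePoint (k + 1) (fun l => 2 * m l + (σ l : ℕ))) ↔
      ∏ l, eps 1 ((σ l : ℕ) : ZMod 2) = ∏ l, Qf (mSeq s) (cubePoint k m l) := by
    unfold Cond
    have h1 : ∀ l, cubePoint (k + 1) (fun l => 2 * m l + (σ l : ℕ)) l (2 * mSeq s)
        = ((σ l : ℕ) : ZMod 2) := by
      intro l; rw [hk]; exact point_child_eq (σ l).isLt
    have h2 : ∀ l, Qf (mSeq s) (cubePoint (k + 1) (fun l => 2 * m l + (σ l : ℕ)) l)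
        = Qf (mSeq s) (cubePoint k m l) := by
      intro l; exact Qf_congr fun t ht => child_agree m σ l t (by omega)
    simp only [h1, h2]
  rw [← hC]
  constructor
  · intro h; exact h s hs (by omega)
  · intro h r hr hrk
    by_cases hlt : 2 * mSeq r < k
    · exact ((Good_congr (child_agree m σ)).2 hg) r hr hlt
    · have : r = s := mSeq_inj hr hs (by omega)
      subst this; exact h

lemma tau_val {d : ℕ} (hd : 2 ≤ d) {τ : ℕ → (Fin d → ℕ) → ℂ}
    (hτ : IsTauOf (Fpi (idPerm d)) τ) (k : ℕ) : ∀ m : Fin d → ℕ, (∀ l, m l < 2 ^ k) →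
    Good k (cubePoint k m) → τ k m = 2 ^ Nc k / 2 ^ (d * k) := by
  obtain ⟨_, h0, _, hdiv⟩ := hτ
  induction k with
  | zero =>
    intro m hm _
    have : m = fun _ => 0 := funext fun l => by have := hm l; simp at this; omega
    rw [this, h0]; simp [Nc]
  | succ k ih =>
    intro x hx hG
    let m : Fin d → ℕ := fun l => x l / 2
    let σ : Fin d → Fin 2 := fun l => ⟨x l % 2, Nat.mod_lt _ (by norm_num)⟩
    have hxm : x = fun l => 2 * m l + (σ l : ℕ) := funext fun l => (Nat.div_add_mod _ _).symm
    have hm : ∀ l, m l < 2 ^ k := fun l => by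
      have := hx l; rw [pow_succ] at this; simp only [m]; omega
    rw [hxm] at hG ⊢
    have hgm : Good k (cubePoint k m) := (Good_congr (child_agree m σ)).1 (hG.mono (by omega))
    rw [hdiv k m hm ((meets_iff hd k m).2 hgm) σ, if_pos ((meets_iff hd _ _).2 hG), ih m hm hgm]
    simp only [meets_iff hd]
    have h2 : (2 : ℂ) ^ d ≠ 0 := pow_ne_zero _ two_ne_zero
    have h3 : (2 : ℂ) ^ (d * k) ≠ 0 := pow_ne_zero _ two_ne_zero
    by_cases hk : ∃ s, 1 ≤ s ∧ 2 * mSeq s = k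
    · rw [Nc, if_pos hk]
      obtain ⟨s, hs, hsk⟩ := hk
      simp only [fun σ' => good_child m hgm σ' s hs hsk]
      rw [count_half hd _ (Qf_cases _), pow_succ, Nat.mul_succ, pow_add]
      field_simp
    · rw [Nc, if_neg hk]
      have hall : ∀ σ' : Fin d → Fin 2,
          Good (k + 1) (cubePoint (k + 1) (fun l => 2 * m l + (σ' l : ℕ))) := by
        intro σ' r hr hrk
        have : 2 * mSeq r ≠ k := fun h => hk ⟨r, hr, h⟩
        exact ((Good_congr (child_agree m σ')).2 hgm) r hr (by omega)
      simp only [hall, Finset.filter_true, Finset.card_univ]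
      rw [Nat.mul_succ, pow_add]
      simp only [Fintype.card_pi, Fintype.card_fin, Finset.prod_const, Finset.card_univ]
      push_cast
      rw [pow_zero, mul_one, pow_add, div_div]

lemma tau_zero {d : ℕ} (hd : 2 ≤ d) {τ : ℕ → (Fin d → ℕ) → ℂ}
    (hτ : IsTauOf (Fpi (idPerm d)) τ) (k : ℕ) (m : Fin d → ℕ) (hm : ∀ l, m l < 2 ^ k)
    (h : ¬ Good k (cubePoint k m)) : τ k m = 0 := by
  rw [hτ.2.2.1 k m hm, ← Set.not_nonempty_iff_eq_empty, meets_iff hd]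
  exact h

lemma mem_boxLt {d k : ℕ} {m : Fin d → ℕ} :
    m ∈ boxLt (fun _ : Fin d => 2 ^ k) ↔ ∀ l, m l < 2 ^ k := by
  simp [boxLt, Fintype.mem_piFinset]

/-- integral of `f` against `τ` at resolution `k` -/
def Ssum {d : ℕ} (τ : ℕ → (Fin d → ℕ) → ℂ) (k : ℕ) (f : GD d → ℝ) : ℂ :=
  ∑ m ∈ boxLt (fun _ : Fin d => 2 ^ k), (f (cubePoint k m) : ℂ) * τ k m

lemma box_refine {d k : ℕ} (h : (Fin d → ℕ) → ℂ) :
    ∑ x ∈ boxLt (fun _ : Fin d => 2 ^ (k + 1)), h x =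
      ∑ m ∈ boxLt (fun _ : Fin d => 2 ^ k), ∑ σ : Fin d → Fin 2,
        h (fun l => 2 * m l + (σ l : ℕ)) := by
  rw [← Finset.sum_product']
  symm
  refine Finset.sum_bij' (fun y _ => fun l => 2 * y.1 l + (y.2 l : ℕ))
    (fun x _ => (fun l => x l / 2, fun l => ⟨x l % 2, Nat.mod_lt _ (by norm_num)⟩)) ?_ ?_ ?_ ?_ ?_
  · rintro ⟨m, σ⟩ hy
    simp only [Finset.mem_product, mem_boxLt, Finset.mem_univ, and_true] at hy
    rw [mem_boxLt]
    intro l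
    have := hy l
    have := (σ l).isLt
    rw [pow_succ]; simp only; omega
  · intro x hx
    rw [mem_boxLt] at hx
    simp only [Finset.mem_product, mem_boxLt, Finset.mem_univ, and_true]
    intro l
    have := hx l
    rw [pow_succ] at this; omega
  · rintro ⟨m, σ⟩ _
    ext l
    · have := (σ l).isLt
      simp only; omega
    · have := (σ l).isLt
      simp only; omega
  · intro x _
    funext l
    simp only; omega
  · intros; rfl

lemma Ssum_succ {d : ℕ} {τ : ℕ → (Fin d → ℕ) → ℂ} (hτ : IsQuasimeasure τ) {k : ℕ} {f : GD d → ℝ}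
    (hf : ∀ g h, Agree k g h → f g = f h) : Ssum τ (k + 1) f = Ssum τ k f := by
  unfold Ssum
  rw [box_refine]
  refine Finset.sum_congr rfl fun m hm => ?_
  rw [hτ k m (mem_boxLt.1 hm), Finset.mul_sum]
  refine Finset.sum_congr rfl fun σ _ => ?_
  rw [hf _ _ (child_agree m σ)]

lemma Ssum_le {d : ℕ} {τ : ℕ → (Fin d → ℕ) → ℂ} (hτ : IsQuasimeasure τ) {r k : ℕ} (hrk : r ≤ k)
    {f : GD d → ℝ} (hf : ∀ g h, Agree r g h → f g = f h) : Ssum τ k f = Ssum τ r f := by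
  induction k, hrk using Nat.le_induction with
  | base => rfl
  | succ k hk ih => rw [Ssum_succ hτ fun g h H => hf g h (H.mono hk), ih]

lemma sum_range_two_mul (N : ℕ) (h : ℕ → ℝ) :
    ∑ x ∈ range (2 * N), h x = ∑ x ∈ range N, (h (2 * x + 0) + h (2 * x + 1)) := by
  induction N with
  | zero => simp
  | succ N ih =>
    rw [Nat.mul_succ, Finset.sum_range_succ, Finset.sum_range_succ, ih, Finset.sum_range_succ]
    simp only [add_zero]; ring

lemma digit_sum (k : ℕ) (f : ℕ → ZMod 2 → ℝ) :
    ∑ x ∈ range (2 ^ k), ∏ t ∈ range k, f t (intervalPoint k x t) =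
      ∏ t ∈ range k, (f t 0 + f t 1) := by
  induction k with
  | zero => simp
  | succ k ih =>
    have key : ∀ x b, b < 2 → ∏ t ∈ range (k + 1), f t (intervalPoint (k + 1) (2 * x + b) t) =
        (∏ t ∈ range k, f t (intervalPoint k x t)) * f k (b : ZMod 2) := by
      intro x b hb
      rw [Finset.prod_range_succ, point_child_eq hb]
      congr 1
      exact Finset.prod_congr rfl fun t ht => by rw [point_child_lt hb (Finset.mem_range.1 ht)]
    rw [pow_succ', sum_range_two_mul, Finset.prod_range_succ, ← ih, Finset.sum_mul]
    refine Finset.sum_congr rfl fun x _ => ?_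
    rw [key x 0 (by norm_num), key x 1 (by norm_num)]
    push_cast; ring

/-- the one-dimensional integrand -/
def fac (M p q a : ℕ) (g : DyadicGroup) : ℝ :=
  if ∀ t < M, g t = intervalPoint M a t then
    ((∏ t ∈ range M, eps (bt q t) (g t)) * ∏ t ∈ range M, eps (bt p t) (g (M + t))) * Qf M g
  else 0

lemma fac_sum {M p q a : ℕ} (hp : p < 2 ^ M) (hq : q < 2 ^ M) (ha : a < 2 ^ M) :
    ∑ x ∈ range (2 ^ (2 * M)), fac M p q a (intervalPoint (2 * M) x) =
      if a = p then 2 ^ M * walsh q (intervalPoint M a) else 0 := by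
  let F : ℕ → ZMod 2 → ℝ := fun t v =>
    if t < M then (if v = intervalPoint M a t then eps (bt q t) v else 0)
    else eps (bt p (t - M)) v * eps (bt a (t - M)) v
  have h1 : ∀ g : DyadicGroup, fac M p q a g = ∏ t ∈ range (2 * M), F t (g t) := by
    intro g
    rw [two_mul, Finset.prod_range_add]
    have hr : ∀ u ∈ range M, F (M + u) (g (M + u))
        = eps (bt p u) (g (M + u)) * eps (bt a u) (g (M + u)) := by
      intro u _
      simp only [F]
      rw [if_neg (by omega), Nat.add_sub_cancel_left]
    rw [Finset.prod_congr rfl hr, Finset.prod_mul_distrib]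
    unfold fac
    split_ifs with h
    · have hl : ∀ u ∈ range M, F u (g u) = eps (bt q u) (g u) := by
        intro u hu
        have hu := Finset.mem_range.1 hu
        simp only [F]
        rw [if_pos hu, if_pos (h u hu)]
      rw [Finset.prod_congr rfl hl, mul_assoc]
      congr 2
      refine Finset.prod_congr rfl fun u hu => ?_
      have hu := Finset.mem_range.1 hu
      rw [h _ (by omega), point_lt (by omega)]
      congr 2; omega
    · push Not at h
      obtain ⟨t, ht, hne⟩ := h
      rw [Finset.prod_eq_zero (Finset.mem_range.2 ht), zero_mul]
      simp only [F]
      rw [if_pos ht, if_neg hne]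
  simp only [h1]
  rw [digit_sum, two_mul, Finset.prod_range_add]
  have hL : ∏ t ∈ range M, (F t 0 + F t 1) = walsh q (intervalPoint M a) := by
    rw [walsh_eq hq]
    refine Finset.prod_congr rfl fun t ht => ?_
    have ht := Finset.mem_range.1 ht
    simp only [F, if_pos ht]
    rcases zmod_cases (intervalPoint M a t) with h | h <;> simp [h]
  rw [hL]
  have hR : ∀ u, F (M + u) 0 + F (M + u) 1 = if bt p u = bt a u then 2 else 0 := by
    intro u
    simp only [F]
    rw [if_neg (by omega), if_neg (by omega), Nat.add_sub_cancel_left]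
    rcases zmod_cases (bt p u) with h | h <;> rcases zmod_cases (bt a u) with h' | h' <;>
      simp [h, h', eps] <;> norm_num
  simp only [hR]
  split_ifs with hap
  · subst hap
    simp [mul_comm]
  · have : ∃ u < M, bt p u ≠ bt a u := by
      by_contra hc
      push Not at hc
      apply hap
      refine point_inj ha hp fun t ht => ?_
      rw [point_lt ht, point_lt ht, hc _ (by omega)]
    obtain ⟨u, hu, hne⟩ := this
    rw [Finset.prod_eq_zero (Finset.mem_range.2 hu) (if_neg hne), mul_zero]

lemma walsh_congr {n k : ℕ} (hn : n < 2 ^ k) {g h : DyadicGroup} (H : ∀ t < k, g t = h t) :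
    walsh n g = walsh n h := by
  rw [walsh_eq hn, walsh_eq hn]
  exact Finset.prod_congr rfl fun t ht => by rw [H t (Finset.mem_range.1 ht)]

lemma fac_congr {M p q a : ℕ} {g h : DyadicGroup} (H : ∀ t < 2 * M, g t = h t) :
    fac M p q a g = fac M p q a h := by
  have h1 : (∀ t < M, g t = intervalPoint M a t) ↔ (∀ t < M, h t = intervalPoint M a t) :=
    forall_congr' fun t => forall_congr' fun ht => by rw [H t (by omega)]
  unfold fac
  simp only [h1, Qf_congr H]
  have h2 : ∏ t ∈ range M, eps (bt q t) (g t) = ∏ t ∈ range M, eps (bt q t) (h t) :=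
    Finset.prod_congr rfl fun t ht => by
      have := Finset.mem_range.1 ht
      rw [H t (by omega)]
  have h3 : ∏ t ∈ range M, eps (bt p t) (g (M + t)) = ∏ t ∈ range M, eps (bt p t) (h (M + t)) :=
    Finset.prod_congr rfl fun t ht => by
      have := Finset.mem_range.1 ht
      rw [H _ (by omega)]
  rw [h2, h3]

lemma sub_Ftil {d s : ℕ} (hs : 1 ≤ s) (m : Fin d → ℕ) :
    dyadicCube (mSeq s) m ⊆ Ftil (idPerm d) (s - 1) ↔ Good (mSeq s) (cubePoint (mSeq s) m) := by
  have hF : ∀ g : GD d, g ∈ Ftil (idPerm d) (s - 1) ↔ ∀ j, 1 ≤ j ∧ j ≤ s - 1 → Cond (mSeq j) g := by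
    intro g
    simp only [Ftil, Set.mem_iInter, mem_Fspi, Finset.mem_Icc]
  constructor
  · intro h j hj hjs
    refine (hF _).1 (h (mem_cube.2 (Agree.refl _ _))) j ⟨hj, ?_⟩
    have : j < s := lt_of_mSeq_lt hs (by omega)
    omega
  · intro h g hg
    rw [hF]
    rintro j ⟨hj, hjs⟩
    exact (Good_congr (mem_cube.1 hg)).2 h j hj (mSeq_lt hj (by omega))

lemma local_coeff {d : ℕ} (hd : 2 ≤ d) {τ : ℕ → (Fin d → ℕ) → ℂ}
    (hτ : IsTauOf (Fpi (idPerm d)) τ) {s : ℕ} (hs : 1 ≤ s)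
    {p q : Fin d → ℕ} (hp : ∀ l, p l < 2 ^ mSeq s) (hq : ∀ l, q l < 2 ^ mSeq s)
    {n : Fin d → ℕ} (hn : n = fun l => 2 ^ (2 * mSeq s) + 2 ^ mSeq s * p l + q l)
    (m : Fin d → ℕ) (hm : ∀ l, m l < 2 ^ mSeq s) (k : ℕ) (hk : 2 * mSeq s + 1 ≤ k) :
    localCoeffAt τ n (mSeq s) m k =
      if m = p ∧ dyadicCube (mSeq s) m ⊆ Ftil (idPerm d) (s - 1) then
        (2 : ℂ) ^ (s - 1) / (2 : ℂ) ^ (d * mSeq s) * (walshValD (mSeq s) q m : ℂ)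
      else 0 := by
  rw [sub_Ftil hs]
  set M := mSeq s with hM
  have hnlt : ∀ l, n l < 2 ^ (2 * M + 1) := by
    intro l
    have : 2 ^ M * p l + q l < 2 ^ (2 * M) := by
      have := hp l
      have := hq l
      rw [two_mul, pow_add]; nlinarith
    rw [hn, pow_succ]; simp only; omega
  let f : GD d → ℝ := fun g => if Agree M g (cubePoint M m) then walshD n g else 0
  have e1 : localCoeffAt τ n M m k = Ssum τ k f := by
    unfold localCoeffAt Ssum
    rw [Finset.sum_filter]
    refine Finset.sum_congr rfl fun x _ => ?_
    rw [cube_sub (show M ≤ k by omega)]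
    simp only [f, walshValD]
    split_ifs <;> simp
  have hf : ∀ g h, Agree (2 * M + 1) g h → f g = f h := by
    intro g h H
    have h1 : Agree M g (cubePoint M m) ↔ Agree M h (cubePoint M m) :=
      ⟨fun h' => (H.symm.mono (by omega)).trans h', fun h' => (H.mono (by omega)).trans h'⟩
    have h2 : walshD n g = walshD n h :=
      Finset.prod_congr rfl fun l _ => walsh_congr (hnlt l) (H l)
    simp only [f, h1, h2]
  rw [e1, Ssum_le hτ.1 hk hf]
  let f' : GD d → ℝ := fun g => ∏ l, fac M (p l) (q l) (m l) (g l)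
  have hff : ∀ g : GD d, Cond M g → f g = f' g := by
    intro g hg
    simp only [f, f']
    by_cases hA : Agree M g (cubePoint M m)
    · rw [if_pos hA]
      have h1 : ∀ l, fac M (p l) (q l) (m l) (g l) = ((∏ t ∈ range M, eps (bt (q l) t) (g l t)) *
          ∏ t ∈ range M, eps (bt (p l) t) (g l (M + t))) * Qf M (g l) := by
        intro l
        rw [fac, if_pos (show ∀ t < M, g l t = intervalPoint M (m l) t from hA l)]
      simp only [walshD, hn, h1]
      simp only [fun l => walsh_split (hp l) (hq l) (g l)]
      rw [Finset.prod_mul_distrib, Finset.prod_mul_distrib (g := fun l => Qf M (g l)), hg]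
    · rw [if_neg hA]
      have : ∃ l, ¬ ∀ t < M, g l t = intervalPoint M (m l) t := by
        by_contra hc
        push Not at hc
        exact hA hc
      obtain ⟨l, hl⟩ := this
      rw [Finset.prod_eq_zero (Finset.mem_univ l)]
      rw [fac, if_neg hl]
  have e2 : Ssum τ (2 * M + 1) f = Ssum τ (2 * M + 1) f' := by
    refine Finset.sum_congr rfl fun x hx => ?_
    by_cases hG : Good (2 * M + 1) (cubePoint (2 * M + 1) x)
    · rw [hff _ (hG s hs (by omega))]
    · rw [tau_zero hd hτ _ x (mem_boxLt.1 hx) hG, mul_zero, mul_zero]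
  have hf' : ∀ g h, Agree (2 * M) g h → f' g = f' h := fun g h H =>
    Finset.prod_congr rfl fun l _ => fac_congr (H l)
  rw [e2, Ssum_succ hτ.1 hf']
  have hz : ∀ x : Fin d → ℕ, ¬ Agree M (cubePoint (2 * M) x) (cubePoint M m) →
      f' (cubePoint (2 * M) x) = 0 := by
    intro x hA
    have : ∃ l, ¬ ∀ t < M, cubePoint (2 * M) x l t = intervalPoint M (m l) t := by
      by_contra hc
      push Not at hc
      exact hA hc
    obtain ⟨l, hl⟩ := this
    simp only [f']
    rw [Finset.prod_eq_zero (Finset.mem_univ l)]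
    rw [fac, if_neg hl]
  by_cases hG : Good M (cubePoint M m)
  · have e3 : Ssum τ (2 * M) f' = ((∑ x ∈ boxLt (fun _ : Fin d => 2 ^ (2 * M)),
        f' (cubePoint (2 * M) x) : ℝ) : ℂ) * (2 ^ (s - 1) / 2 ^ (d * (2 * M))) := by
      unfold Ssum
      push_cast
      rw [Finset.sum_mul]
      refine Finset.sum_congr rfl fun x hx => ?_
      by_cases hA : Agree M (cubePoint (2 * M) x) (cubePoint M m)
      · rw [tau_val hd hτ _ x (mem_boxLt.1 hx), Nc_val s hs]
        intro j hj hjs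
        have : j < s := lt_of_mSeq_lt hs (by omega)
        exact (Good_congr hA).2 hG j hj (mSeq_lt hj this)
      · rw [hz x hA]; simp
    rw [e3]
    have e4 : ∑ x ∈ boxLt (fun _ : Fin d => 2 ^ (2 * M)), f' (cubePoint (2 * M) x) =
        if m = p then 2 ^ (d * M) * walshValD M q m else 0 := by
      simp only [f', boxLt, cubePoint]
      rw [← Finset.prod_univ_sum (fun _ : Fin d => range (2 ^ (2 * M)))
        (fun l x => fac M (p l) (q l) (m l) (intervalPoint (2 * M) x))]
      simp only [fun l => fac_sum (hp l) (hq l) (hm l)]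
      split_ifs with h
      · subst h
        simp [Finset.prod_mul_distrib, walshValD, walshD, cubePoint, ← pow_mul, mul_comm]
      · have : ∃ l, m l ≠ p l := by
          by_contra hc
          push Not at hc
          exact h (funext hc)
        obtain ⟨l, hl⟩ := this
        exact Finset.prod_eq_zero (Finset.mem_univ l) (if_neg hl)
    rw [e4]
    by_cases h : m = p
    · rw [if_pos h, if_pos ⟨h, hG⟩]
      have h3 : (2 : ℂ) ^ (d * M) ≠ 0 := pow_ne_zero _ two_ne_zero
      rw [show d * (2 * M) = d * M + d * M by ring, pow_add]
      push_cast
      field_simp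
    · rw [if_neg h, if_neg (fun h' => h h'.1)]; simp
  · rw [if_neg (fun h' => hG h'.2)]
    refine Finset.sum_eq_zero fun x hx => ?_
    by_cases hA : Agree M (cubePoint (2 * M) x) (cubePoint M m)
    · rw [tau_zero hd hτ _ x (mem_boxLt.1 hx), mul_zero]
      intro h
      exact hG ((Good_congr hA).1 (h.mono (by omega)))
    · rw [hz x hA]; simp

lemma fourier_eq_sum {d : ℕ} (τ : ℕ → (Fin d → ℕ) → ℂ) (n : Fin d → ℕ) {r k : ℕ} (hr : r ≤ k) :
    fourierCoeffAt τ n k = ∑ m ∈ boxLt (fun _ : Fin d => 2 ^ r), localCoeffAt τ n r m k := by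
  unfold fourierCoeffAt localCoeffAt
  simp only [Finset.sum_filter, cube_sub hr]
  rw [Finset.sum_comm]
  refine Finset.sum_congr rfl fun x _ => ?_
  choose a ha hxa using fun l => exists_point r (cubePoint k x l)
  rw [Finset.sum_eq_single a]
  · rw [if_pos]; exact hxa
  · intro b hb hne
    rw [if_neg]
    intro hA
    apply hne
    funext l
    exact point_inj (mem_boxLt.1 hb l) (ha l) fun t ht => by
      rw [← hxa l t ht, hA l t ht]; rfl
  · intro h
    exact absurd (mem_boxLt.2 ha) h

/-- local and global Fourier–Walsh coefficients of `τ = τ_F` at indices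
`𝐧 = 2^{2m_s}𝟏 + 2^{m_s}𝐩 + 𝐪`. -/
theorem statement9 (d : ℕ) (hd : 2 ≤ d) (τ : ℕ → (Fin d → ℕ) → ℂ)
    (hτ : IsTauOf (Fpi (idPerm d)) τ) (s : ℕ) (hs : 1 ≤ s)
    (p q : Fin d → ℕ) (hp : ∀ l, p l < 2 ^ mSeq s) (hq : ∀ l, q l < 2 ^ mSeq s)
    (n : Fin d → ℕ) (hn : n = fun l => 2 ^ (2 * mSeq s) + 2 ^ mSeq s * p l + q l) :
    (∀ m : Fin d → ℕ, (∀ l, m l < 2 ^ mSeq s) →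
      ∀ k : ℕ, (∀ l, n l < 2 ^ k) → mSeq s ≤ k →
        localCoeffAt τ n (mSeq s) m k =
          if m = p ∧ dyadicCube (mSeq s) m ⊆ Ftil (idPerm d) (s - 1) then
            (2 : ℂ) ^ (s - 1) / (2 : ℂ) ^ (d * mSeq s) * (walshValD (mSeq s) q m : ℂ)
          else 0) ∧
    (∀ k : ℕ, (∀ l, n l < 2 ^ k) →
      fourierCoeffAt τ n k =
        if dyadicCube (mSeq s) p ⊆ Ftil (idPerm d) (s - 1) then
          (2 : ℂ) ^ (s - 1) / (2 : ℂ) ^ (d * mSeq s) * (walshValD (mSeq s) q p : ℂ)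
        else 0) := by
  have hk' : ∀ k : ℕ, (∀ l, n l < 2 ^ k) → 2 * mSeq s + 1 ≤ k := by
    intro k hk
    have h1 := hk ⟨0, by omega⟩
    rw [hn] at h1
    simp only at h1
    have h2 : 2 ^ (2 * mSeq s) < 2 ^ k := by omega
    exact (Nat.pow_lt_pow_iff_right (by norm_num)).1 h2
  refine ⟨fun m hm k hk _ => local_coeff hd hτ hs hp hq hn m hm k (hk' k hk), fun k hk => ?_⟩
  have h3 := hk' k hk
  rw [fourier_eq_sum τ n (show mSeq s ≤ k by omega),
    Finset.sum_congr rfl fun m hm =>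
      local_coeff hd hτ hs hp hq hn m (mem_boxLt.1 hm) k h3,
    Finset.sum_eq_single p]
  · simp only [true_and]
  · intro b _ hb
    rw [if_neg (fun h => hb h.1)]
  · intro h
    exact absurd (mem_boxLt.2 hp) h
end
end
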